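/- arXiv:1106.1247 — 2 statements merged into one kernel-verified Lean document; each statement's English description precedes it below -/
import Mathlib

section
/- Let D be a ℂ-linear subspace of M_{2×n}(ℂ) such that D_1 = {V ∈ D : rank V ≤ 1} is a subspace of the form D_1 = {αη* : η ∈ B} for a nonzero α ∈ ℂ² and a subspace B ⊆ ℂⁿ with k = dim_ℂ B. Let p ∈ M_n(ℂ) be the orthogonal projection onto B and D_2 = D ∩ D_1^⊥. If a_1, …, a_ℓ ∈ D_2 are such that the matrices a_1(1_n − p), …, a_ℓ(1_n − p) all have rank 1 and are linearly independent, then ℓ ≤ min(k, n − k). -/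
open Matrix Kronecker
open scoped ComplexOrder

noncomputable section


/-- Orthogonal complement of a set of vectors in `ℂⁿ` w.r.t. the standard inner product. -/
def vPerp {n : ℕ} (B : Submodule ℂ (Fin n → ℂ)) : Submodule ℂ (Fin n → ℂ) where
  carrier := {γ | ∀ η ∈ B, ∑ j, star (η j) * γ j = 0}
  add_mem' := by
    intro a b ha hb η hη
    have h1 := ha η hη
    have h2 := hb η hη
    simp only [Pi.add_apply, mul_add, Finset.sum_add_distrib]
    rw [h1, h2, add_zero]
  zero_mem' := by intro η hη; simp
  smul_mem' := by
    intro c a ha η hη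
    have h := ha η hη
    simp only [Pi.smul_apply, smul_eq_mul]
    calc ∑ j, star (η j) * (c * a j) = c * ∑ j, star (η j) * a j := by
          rw [Finset.mul_sum]; exact Finset.sum_congr rfl fun j _ => by ring
      _ = 0 := by rw [h, mul_zero]

/-- Orthogonal complement of a set of matrices w.r.t. the Hilbert–Schmidt inner product. -/
def hsPerp {m n : ℕ} (S : Set (Matrix (Fin m) (Fin n) ℂ)) :
    Submodule ℂ (Matrix (Fin m) (Fin n) ℂ) where
  carrier := {W | ∀ V ∈ S, ∑ i, ∑ j, star (V i j) * W i j = 0}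
  add_mem' := by
    intro a b ha hb V hV
    have h1 := ha V hV
    have h2 := hb V hV
    simp only [Matrix.add_apply, mul_add, Finset.sum_add_distrib]
    rw [h1, h2, add_zero]
  zero_mem' := by intro V hV; simp
  smul_mem' := by
    intro c a ha V hV
    have h := ha V hV
    simp only [Matrix.smul_apply, smul_eq_mul]
    calc ∑ i, ∑ j, star (V i j) * (c * a i j)
        = c * ∑ i, ∑ j, star (V i j) * a i j := by
          rw [Finset.mul_sum]
          exact Finset.sum_congr rfl fun i _ => by
            rw [Finset.mul_sum]; exact Finset.sum_congr rfl fun j _ => by ring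
      _ = 0 := by rw [h, mul_zero]

/-- `p` is the orthogonal projection matrix onto the subspace `B` of `ℂⁿ`. -/
def IsOrthProjOnto {n : ℕ} (p : Matrix (Fin n) (Fin n) ℂ) (B : Submodule ℂ (Fin n → ℂ)) : Prop :=
  p.IsHermitian ∧ p * p = p ∧ (∀ η ∈ B, p.mulVec η = η) ∧ (∀ η, p.mulVec η ∈ B)

/-- A matrix with two rows has rank at most one iff its rows are linearly dependent. -/
theorem rank_le_one_iff_exists_vecMul_eq_zero {n : ℕ} (M : Matrix (Fin 2) (Fin n) ℂ) :
    M.rank ≤ 1 ↔ ∃ w ≠ 0, w ᵥ* M = 0 := by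
  have hnull := Mᵀ.mulVecLin.finrank_range_add_finrank_ker
  rw [← Matrix.rank, rank_transpose, Module.finrank_fin_fun] at hnull
  have hker : (∃ w ≠ 0, w ᵥ* M = 0) ↔ LinearMap.ker Mᵀ.mulVecLin ≠ ⊥ := by
    rw [Submodule.ne_bot_iff]
    simp only [LinearMap.mem_ker, mulVecLin_apply, mulVec_transpose]
    exact exists_congr fun w => and_comm
  rw [hker, ← Submodule.one_le_finrank_iff]
  lia

/-- Linearly independent vectors fixed by `q` number at most the rank of `q`. -/
theorem card_le_rank_of_vecMul_eq_self {ι : Type*} [Fintype ι] {n : ℕ}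
    {q : Matrix (Fin n) (Fin n) ℂ} {y : ι → Fin n → ℂ} (hy : LinearIndependent ℂ y)
    (hq : ∀ i, y i ᵥ* q = y i) : Fintype.card ι ≤ q.rank := by
  rw [← finrank_span_eq_card hy, ← rank_transpose, Matrix.rank]
  refine Submodule.finrank_mono (Submodule.span_le.2 ?_)
  rintro _ ⟨i, rfl⟩
  exact ⟨y i, by rw [mulVecLin_apply, mulVec_transpose, hq]⟩

theorem IsOrthProjOnto.rank_eq_finrank {n : ℕ} {p : Matrix (Fin n) (Fin n) ℂ}
    {B : Submodule ℂ (Fin n → ℂ)} (hp : IsOrthProjOnto p B) : p.rank = Module.finrank ℂ B := by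
  have : LinearMap.range p.mulVecLin = B := by
    ext η
    exact ⟨by rintro ⟨x, rfl⟩; exact hp.2.2.2 x, fun h => ⟨η, hp.2.2.1 η h⟩⟩
  rw [Matrix.rank, this]

theorem IsOrthProjOnto.star_vecMul_mem {n : ℕ} {p : Matrix (Fin n) (Fin n) ℂ}
    {B : Submodule ℂ (Fin n → ℂ)} (hp : IsOrthProjOnto p B) (x : Fin n → ℂ) :
    star (x ᵥ* p) ∈ B := by
  rw [star_vecMul, hp.1.eq]
  exact hp.2.2.2 _

theorem IsOrthProjOnto.vecMulVec_star_mul_one_sub {n : ℕ} {p : Matrix (Fin n) (Fin n) ℂ}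
    {B : Submodule ℂ (Fin n → ℂ)} (hp : IsOrthProjOnto p B) (α : Fin 2 → ℂ) {η : Fin n → ℂ}
    (hη : η ∈ B) : vecMulVec α (star η) * (1 - p) = 0 := by
  have : star η ᵥ* p = star η := by
    rw [← hp.1.eq, ← star_mulVec, hp.2.2.1 η hη]
  rw [vecMulVec_mul, vecMul_sub, vecMul_one, this, sub_self]
  ext
  simp [vecMulVec_apply]

/-- If `V (1 - p)` has rank one for some `V ∈ D`, then its left kernel annihilates `α`. -/
theorem dotProduct_eq_zero_of_vecMul_eq_zero {n : ℕ}
    {D : Submodule ℂ (Matrix (Fin 2) (Fin n) ℂ)} {α : Fin 2 → ℂ} {B : Submodule ℂ (Fin n → ℂ)}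
    (hD1 : {V | V ∈ D ∧ V.rank ≤ 1} =
      {M : Matrix (Fin 2) (Fin n) ℂ | ∃ η ∈ B, M = vecMulVec α (star η)})
    {p : Matrix (Fin n) (Fin n) ℂ} (hp : IsOrthProjOnto p B)
    {V : Matrix (Fin 2) (Fin n) ℂ} (hV : V ∈ D) (hV0 : V * (1 - p) ≠ 0)
    {w : Fin 2 → ℂ} (hw : w ≠ 0) (hwV : w ᵥ* (V * (1 - p)) = 0) : w ⬝ᵥ α = 0 := by
  by_contra hs
  set η : Fin n → ℂ := star (-(w ⬝ᵥ α)⁻¹ • (w ᵥ* V ᵥ* p)) with hη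
  have hηB : η ∈ B := by
    rw [hη, star_smul]
    exact B.smul_mem _ (hp.star_vecMul_mem _)
  have hηD : vecMulVec α (star η) ∈ D :=
    (hD1.ge ⟨η, hηB, rfl⟩ : vecMulVec α (star η) ∈ {V | V ∈ D ∧ V.rank ≤ 1}).1
  have hwVp : w ᵥ* V = w ᵥ* V ᵥ* p := by
    rwa [← vecMul_vecMul, vecMul_sub, vecMul_one, sub_eq_zero] at hwV
  have hker : w ᵥ* (V + vecMulVec α (star η)) = 0 := by
    rw [vecMul_add, vecMul_vecMulVec, hη, star_star, smul_smul, mul_neg, mul_inv_cancel₀ hs,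
      ← hwVp, neg_one_smul, add_neg_cancel]
  obtain ⟨ζ, hζ, hζV⟩ := hD1.le
    ⟨D.add_mem hV hηD, (rank_le_one_iff_exists_vecMul_eq_zero _).2 ⟨w, hw, hker⟩⟩
  apply hV0
  rw [eq_sub_of_add_eq hζV, Matrix.sub_mul, hp.vecMulVec_star_mul_one_sub α hζ,
    hp.vecMulVec_star_mul_one_sub α hηB, sub_zero]

/-- Two vectors of `ℂ²` annihilating the same nonzero vector are proportional. -/
theorem exists_smul_eq_of_dotProduct_eq_zero {α w : Fin 2 → ℂ} (hα : α ≠ 0)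
    (hw : w ⬝ᵥ α = 0) : ∃ c : ℂ, w = c • ![α 1, -α 0] := by
  rw [dotProduct, Fin.sum_univ_two] at hw
  by_cases h0 : α 0 = 0
  · have h1 : α 1 ≠ 0 := fun h1 => hα (by ext i; fin_cases i <;> assumption)
    have hw1 : w 1 = 0 := by simpa [h0, h1] using hw
    refine ⟨w 0 / α 1, ?_⟩
    ext i
    fin_cases i
    · simp [h1]
    · simp [h0, hw1]
  · refine ⟨-(w 1 / α 0), ?_⟩
    ext i
    fin_cases i
    · simp
      field_simp
      linear_combination hw
    · simp [h0]

theorem eq_zero_of_vecMul_eq_zero {n : ℕ} {α : Fin 2 → ℂ} (hα : α ≠ 0)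
    {M : Matrix (Fin 2) (Fin n) ℂ} (h₁ : star α ᵥ* M = 0) (h₂ : ![α 1, -α 0] ᵥ* M = 0) :
    M = 0 := by
  have hN : star α ⬝ᵥ α ≠ 0 := dotProduct_star_self_eq_zero.not.2 hα
  rw [dotProduct, Fin.sum_univ_two] at hN
  ext i j
  have e₁ := congrFun h₁ j
  have e₂ := congrFun h₂ j
  simp only [vecMul, dotProduct, Fin.sum_univ_two, Pi.zero_apply, cons_val_zero,
    cons_val_one] at e₁ e₂
  apply (mul_eq_zero.1 _).resolve_left hN
  fin_cases i
  · simp only [Fin.zero_eta]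
    linear_combination α 0 * e₁ + star α 1 * e₂
  · simp only [Fin.mk_one]
    linear_combination α 1 * e₁ - star α 0 * e₂

/-- The maximum number of linearly independent rank-one matrices in `D₂(1-p)` is at most
`min(k, n-k)`, where `k = dim B`. -/
theorem stmt4 (n : ℕ) (D : Submodule ℂ (Matrix (Fin 2) (Fin n) ℂ))
    (α : Fin 2 → ℂ) (hα : α ≠ 0) (B : Submodule ℂ (Fin n → ℂ))
    (hD1 : {V | V ∈ D ∧ V.rank ≤ 1} =
      {M : Matrix (Fin 2) (Fin n) ℂ | ∃ η ∈ B, M = vecMulVec α (star η)})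
    (p : Matrix (Fin n) (Fin n) ℂ) (hp : IsOrthProjOnto p B)
    (ℓ : ℕ) (a : Fin ℓ → Matrix (Fin 2) (Fin n) ℂ)
    (ha : ∀ i, a i ∈ D ⊓ hsPerp {V | V ∈ D ∧ V.rank ≤ 1})
    (hrk : ∀ i, (a i * (1 - p)).rank = 1)
    (hli : LinearIndependent ℂ fun i => a i * (1 - p)) :
    ℓ ≤ min (Module.finrank ℂ B) (n - Module.finrank ℂ B) := by
  set β : Fin 2 → ℂ := ![α 1, -α 0] with hβ
  have hβ0 : β ≠ 0 := fun h => hα <| by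
    have h0 := congrFun h 0
    have h1 := congrFun h 1
    ext i
    fin_cases i
    · simpa [hβ] using h1
    · simpa [hβ] using h0
  have hβa : ∀ i, β ᵥ* (a i * (1 - p)) = 0 := fun i => by
    obtain ⟨w, hw, hwa⟩ := (rank_le_one_iff_exists_vecMul_eq_zero _).1 (hrk i).le
    obtain ⟨c, rfl⟩ := exists_smul_eq_of_dotProduct_eq_zero hα
      (dotProduct_eq_zero_of_vecMul_eq_zero hD1 hp (ha i).1 (hli.ne_zero i) hw hwa)
    rw [smul_vecMul] at hwa
    exact (smul_eq_zero.1 hwa).resolve_left fun hc => hw (by rw [hc, zero_smul])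
  rw [Fintype.linearIndependent_iff] at hli
  have hx : LinearIndependent ℂ fun i => star α ᵥ* (a i * (1 - p)) := by
    rw [Fintype.linearIndependent_iff]
    intro g hg
    refine hli g (eq_zero_of_vecMul_eq_zero hα ?_ ?_)
    · simpa only [vecMul_sum, vecMul_smul] using hg
    · simp only [vecMul_sum, vecMul_smul, ← hβ, hβa, smul_zero, Finset.sum_const_zero]
  have hy : LinearIndependent ℂ fun i => β ᵥ* a i := by
    rw [Fintype.linearIndependent_iff]
    intro g hg
    refine hli g ?_
    have hker : β ᵥ* ∑ i, g i • a i = 0 := by simpa only [vecMul_sum, vecMul_smul] using hg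
    obtain ⟨η, hη, hηa⟩ := hD1.le
      ⟨D.sum_mem fun i _ => D.smul_mem (g i) (ha i).1,
        (rank_le_one_iff_exists_vecMul_eq_zero _).2 ⟨β, hβ0, hker⟩⟩
    simp only [← smul_mul, ← Matrix.sum_mul]
    rw [hηa, hp.vecMulVec_star_mul_one_sub α hη]
  have hpp : p * (1 - p) = 0 := by rw [mul_sub, mul_one, hp.2.1, sub_self]
  have hqq : (1 - p) * (1 - p) = 1 - p := by rw [sub_mul, one_mul, hpp, sub_zero]
  have hcx := card_le_rank_of_vecMul_eq_self (q := 1 - p) hx fun i => by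
    rw [vecMul_vecMul, Matrix.mul_assoc, hqq]
  have hcy := card_le_rank_of_vecMul_eq_self (q := p) hy fun i => by
    have h := hβa i
    rw [← vecMul_vecMul, vecMul_sub, vecMul_one, sub_eq_zero] at h
    exact h.symm
  have hsum := rank_add_rank_le_card_of_mul_eq_zero hpp
  rw [Fintype.card_fin] at hcx hcy hsum
  rw [hp.rank_eq_finrank] at hcy hsum
  lia

end
end

section
/- Let D be a ℂ-linear subspace of M_{2×n}(ℂ) such that D_1 = {V ∈ D : rank V ≤ 1} is a subspace of the form D_1 = {αη* : η ∈ B} for a unit vector α ∈ ℂ² and a subspace B ⊆ ℂⁿ. Let α^⊥ ∈ ℂ² be a unit vector orthogonal to α, let p ∈ M_n(ℂ) be the orthogonal projection onto B, let D_2 = D ∩ D_1^⊥, and let a_1, …, a_ℓ be a basis of D_2, with the (unique) decompositions a_i = αγ_i* + α^⊥(β_i + δ_i)* where β_i ∈ B and γ_i, δ_i ∈ B^⊥. Then {δ_1, …, δ_ℓ} is linearly independent if and only if the subspace {a(1_n − p) : a ∈ D_2} of M_{2×n}(ℂ) contains no matrix of rank 1. -/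
open Matrix Kronecker
open scoped ComplexOrder

noncomputable section


theorem vecMulVec_zero_right {m n R : Type*} [MulZeroClass R] (u : m → R) :
    vecMulVec u (0 : n → R) = 0 := by
  ext
  simp [vecMulVec_apply]

theorem exists_eq_vecMulVec_of_rank_le_one {m n K : Type*} [Fintype m] [Fintype n] [DecidableEq n]
    [Field K] {M : Matrix m n K} (h : M.rank ≤ 1) : ∃ u v, M = vecMulVec u v := by
  obtain ⟨u, hu⟩ := (Submodule.finrank_le_one_iff_isPrincipal (LinearMap.range M.mulVecLin)).1 h
  have hcol : ∀ j, ∃ c : K, c • u = M *ᵥ Pi.single j 1 := fun j =>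
    Submodule.mem_span_singleton.1 (hu ▸ LinearMap.mem_range_self M.mulVecLin (Pi.single j 1))
  choose v hv using hcol
  refine ⟨u, v, ?_⟩
  ext i j
  have := congrFun (hv j) i
  simp only [mulVec_single_one, Pi.smul_apply, smul_eq_mul, col_apply] at this
  rw [vecMulVec_apply, ← this, mul_comm]

theorem IsOrthProjOnto.mulVec_eq_zero {n : ℕ} {p : Matrix (Fin n) (Fin n) ℂ}
    {B : Submodule ℂ (Fin n → ℂ)} (hp : IsOrthProjOnto p B) {v : Fin n → ℂ} (hv : v ∈ vPerp B) :
    p *ᵥ v = 0 := by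
  obtain ⟨hH, hI, -, hB⟩ := hp
  have h : star (p *ᵥ v) ⬝ᵥ v = 0 := hv _ (hB v)
  refine dotProduct_star_self_eq_zero.1 ?_
  rw [star_mulVec, hH.eq] at h ⊢
  rw [← dotProduct_mulVec, mulVec_mulVec, hI, dotProduct_mulVec, h]

theorem vecMulVec_star_mul_one_sub {m n : ℕ} {p : Matrix (Fin n) (Fin n) ℂ}
    (hp : p.IsHermitian) (u : Fin m → ℂ) (v : Fin n → ℂ) :
    vecMulVec u (star v) * (1 - p) = vecMulVec u (star (v - p *ᵥ v)) := by
  rw [vecMulVec_mul, vecMul_sub, vecMul_one, star_sub, star_mulVec, hp.eq]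

theorem sum_smul_vecMulVec_star {ι : Type*} [Fintype ι] {m n : ℕ} (c : ι → ℂ) (u : Fin m → ℂ)
    (v : ι → Fin n → ℂ) :
    ∑ i, c i • vecMulVec u (star (v i)) = vecMulVec u (star (∑ i, star (c i) • v i)) := by
  ext j k
  simp only [Matrix.sum_apply, Matrix.smul_apply, vecMulVec_apply, Pi.star_apply,
    Finset.sum_apply, Pi.smul_apply, smul_eq_mul, star_sum, star_mul', star_star, Finset.mul_sum]
  exact Finset.sum_congr rfl fun i _ => by ring

/-- With the decompositions `aᵢ = α γᵢ* + α^⊥ (βᵢ + δᵢ)*` for a basis of `D₂`, the family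
`{δᵢ}` is linearly independent iff `D₂(1-p)` contains no rank-one matrix. -/
theorem stmt5 (n : ℕ) (D : Submodule ℂ (Matrix (Fin 2) (Fin n) ℂ))
    (α : Fin 2 → ℂ) (hα : ∑ i, star (α i) * α i = 1)
    (αp : Fin 2 → ℂ) (hαp : ∑ i, star (αp i) * αp i = 1)
    (horth : ∑ i, star (α i) * αp i = 0)
    (B : Submodule ℂ (Fin n → ℂ))
    (hD1 : {V | V ∈ D ∧ V.rank ≤ 1} =
      {M : Matrix (Fin 2) (Fin n) ℂ | ∃ η ∈ B, M = vecMulVec α (star η)})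
    (p : Matrix (Fin n) (Fin n) ℂ) (hp : IsOrthProjOnto p B)
    (ℓ : ℕ) (a : Fin ℓ → Matrix (Fin 2) (Fin n) ℂ)
    (ha_li : LinearIndependent ℂ a)
    (ha_span : Submodule.span ℂ (Set.range a) = D ⊓ hsPerp {V | V ∈ D ∧ V.rank ≤ 1})
    (β γ δ : Fin ℓ → (Fin n → ℂ))
    (hβ : ∀ i, β i ∈ B) (hγ : ∀ i, γ i ∈ vPerp B) (hδ : ∀ i, δ i ∈ vPerp B)
    (hdec : ∀ i, a i = vecMulVec α (star (γ i)) + vecMulVec αp (star (β i + δ i))) :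
    LinearIndependent ℂ δ ↔
      ∀ b ∈ D ⊓ hsPerp {V | V ∈ D ∧ V.rank ≤ 1}, (b * (1 - p)).rank ≠ 1 := by
  obtain ⟨hH, -, hfix, -⟩ := id hp
  have hαα : star α ⬝ᵥ α = 1 := hα
  have hpp : star αp ⬝ᵥ αp = 1 := hαp
  have hαp0 : star α ⬝ᵥ αp = 0 := horth
  have hpα0 : star αp ⬝ᵥ α = 0 := by
    rw [← star_star (star αp ⬝ᵥ α), ← star_dotProduct, hαp0, star_zero]
  have hD1' : ∀ V ∈ D, V.rank ≤ 1 → ∃ η ∈ B, V = vecMulVec α (star η) := fun V h1 h2 =>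
    (Set.ext_iff.1 hD1 V).1 ⟨h1, h2⟩
  have hD1D : ∀ η ∈ B, vecMulVec α (star η) ∈ D := fun η hη =>
    ((Set.ext_iff.1 hD1 _).2 ⟨η, hη, rfl⟩).1
  have hrankD : ∀ (w : ℂ) (v : Fin n → ℂ), vecMulVec (w • α + αp) (star v) ∈ D → v = 0 := by
    intro w v hv
    obtain ⟨η, -, h⟩ := hD1' _ hv (rank_vecMulVec_le _ _)
    have := congrArg (star αp ᵥ* ·) h
    simpa [vecMul_vecMulVec, hpp, hpα0] using this
  let lc : (Fin ℓ → ℂ) → (Fin ℓ → Fin n → ℂ) → Fin n → ℂ := fun c v => ∑ i, star (c i) • v i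
  have hlc : ∀ (S : Submodule ℂ (Fin n → ℂ)) c v, (∀ i, v i ∈ S) → lc c v ∈ S :=
    fun S c v h => S.sum_mem fun i _ => S.smul_mem _ (h i)
  have hcomb : ∀ c : Fin ℓ → ℂ, ∑ i, c i • a i =
      vecMulVec α (star (lc c γ)) + vecMulVec αp (star (lc c β + lc c δ)) := by
    intro c
    simp only [hdec, smul_add, Finset.sum_add_distrib, sum_smul_vecMulVec_star, lc]
  have hcompr : ∀ c : Fin ℓ → ℂ, (∑ i, c i • a i) * (1 - p) =
      vecMulVec α (star (lc c γ)) + vecMulVec αp (star (lc c δ)) := by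
    intro c
    rw [hcomb, Matrix.add_mul, vecMulVec_star_mul_one_sub hH, vecMulVec_star_mul_one_sub hH, mulVec_add,
      hp.mulVec_eq_zero (hlc _ c γ hγ), hp.mulVec_eq_zero (hlc _ c δ hδ), hfix _ (hlc _ c β hβ)]
    simp
  have hmemD : ∀ c : Fin ℓ → ℂ, ∑ i, c i • a i ∈ D ⊓ hsPerp {V | V ∈ D ∧ V.rank ≤ 1} := by
    intro c
    rw [← ha_span]
    exact Submodule.sum_mem _ fun i _ =>
      Submodule.smul_mem _ _ (Submodule.subset_span (Set.mem_range_self i))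
  constructor
  · intro hli b hb hrank
    rw [← ha_span] at hb
    obtain ⟨c, rfl⟩ := (Submodule.mem_span_range_iff_exists_fun ℂ).1 hb
    obtain ⟨u, v, huv⟩ := exists_eq_vecMulVec_of_rank_le_one hrank.le
    rw [hcompr] at huv
    have hγv : star (lc c γ) = (star α ⬝ᵥ u) • v := by
      simpa [vecMul_add, vecMul_vecMulVec, hαα, hαp0] using congrArg (star α ᵥ* ·) huv
    have hδv : star (lc c δ) = (star αp ⬝ᵥ u) • v := by
      simpa [vecMul_add, vecMul_vecMulVec, hpp, hpα0] using congrArg (star αp ᵥ* ·) huv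
    have hδ0 : lc c δ ≠ 0 := by
      intro h0
      have hc := Fintype.linearIndependent_iff.1 hli (fun i => star (c i)) h0
      simp only [star_eq_zero] at hc
      simp [hc] at hrank
    have ht : star αp ⬝ᵥ u ≠ 0 := by
      rintro h0
      rw [h0, zero_smul, star_eq_zero] at hδv
      exact hδ0 hδv
    set z := (star α ⬝ᵥ u) / (star αp ⬝ᵥ u) with hz
    have hγδ : star (lc c γ) = z • star (lc c δ) := by
      rw [hγv, hδv, smul_smul, hz, div_mul_cancel₀ _ ht]
    have hsum : vecMulVec (z • α + αp) (star (lc c β + lc c δ)) =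
        ∑ i, c i • a i + vecMulVec α (star (star z • lc c β)) := by
      rw [hcomb, hγδ]
      ext i j
      simp [vecMulVec_apply]
      ring
    have h0 : lc c β + lc c δ = 0 := by
      refine hrankD z _ ?_
      rw [hsum]
      exact D.add_mem (hmemD c).1 (hD1D _ (B.smul_mem _ (hlc _ c β hβ)))
    have h1 := congrArg (p *ᵥ ·) h0
    simp only [mulVec_add, hfix _ (hlc _ c β hβ), hp.mulVec_eq_zero (hlc _ c δ hδ), add_zero,
      mulVec_zero] at h1
    rw [h1, zero_add] at h0
    exact hδ0 h0
  · intro hno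
    rw [Fintype.linearIndependent_iff]
    intro g hg i
    let c : Fin ℓ → ℂ := fun i => star (g i)
    have hδ0 : lc c δ = 0 := by simpa [lc, c] using hg
    have hr := hno _ (hmemD c)
    have hle := rank_vecMulVec_le α (star (lc c γ))
    rw [hcompr, hδ0, star_zero, vecMulVec_zero_right, add_zero] at hr
    have hzero : (vecMulVec α (star (lc c γ))).rank = 0 := by omega
    have hγ0 : lc c γ = 0 := by
      have hM : vecMulVec α (star (lc c γ)) = 0 := by
        rw [Matrix.rank, Submodule.finrank_eq_zero, LinearMap.range_eq_bot] at hzero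
        exact mulVec_injective <| funext fun v =>
          (LinearMap.congr_fun hzero v).trans (zero_mulVec v).symm
      simpa [vecMul_vecMulVec, hαα] using congrArg (star α ᵥ* ·) hM
    have hb := hcomb c
    rw [hγ0, hδ0, star_zero, vecMulVec_zero_right, zero_add, add_zero] at hb
    have hβ0 : lc c β = 0 := by
      refine hrankD 0 _ ?_
      rw [zero_smul, zero_add, ← hb]
      exact (hmemD c).1
    rw [hβ0, star_zero, vecMulVec_zero_right] at hb
    simpa [c] using Fintype.linearIndependent_iff.1 ha_li c hb i

end
end
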